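/- Let Ω be a densely defined sectorial sesquilinear form on D ⊆ H with vertex γ ∈ ℝ, and let λ < γ. If Ω is solvable with respect to some norm ‖·‖_Ω with -λι ∈ P₀(Ω), then Ω is closed as a sectorial form, i.e., D equipped with the inner product (Re Ω - λι)(ξ,η) is complete. -/

import Mathlib

noncomputable section

open Filter Topology Function
open scoped InnerProductSpace

namespace Paper

variable {V : Type} [AddCommGroup V] [Module ℂ V]

/-- `n` is a norm on the complex vector space `V`. -/
def IsNormFn (n : V → ℝ) : Prop :=
  (∀ x : V, n x = 0 ↔ x = 0) ∧
    (∀ (c : ℂ) (x : V), n (c • x) = ‖c‖ * n x) ∧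
      ∀ x y : V, n (x + y) ≤ n x + n y

/-- `ξ` is a Cauchy sequence with respect to the norm `n`. -/
def IsCauchyWrt (n : V → ℝ) (ξ : ℕ → V) : Prop :=
  ∀ ε : ℝ, 0 < ε → ∃ N : ℕ, ∀ p q : ℕ, N ≤ p → N ≤ q → n (ξ p - ξ q) < ε

/-- `ξ` tends to `x` with respect to the norm `n`. -/
def TendstoWrt (n : V → ℝ) (ξ : ℕ → V) (x : V) : Prop :=
  Tendsto (fun k => n (ξ k - x)) atTop (𝓝 0)

/-- `V` is complete with respect to the norm `n`. -/
def CompleteWrt (n : V → ℝ) : Prop :=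
  ∀ ξ : ℕ → V, IsCauchyWrt n ξ → ∃ x : V, TendstoWrt n ξ x

/-- The two norms `n₁` and `n₂` are equivalent. -/
def EquivNorms (n₁ n₂ : V → ℝ) : Prop :=
  ∃ c₁ : ℝ, 0 < c₁ ∧ ∃ c₂ : ℝ, 0 < c₂ ∧ ∀ x : V, n₁ x ≤ c₁ * n₂ x ∧ n₂ x ≤ c₂ * n₁ x

/-- `Ω` is a sesquilinear form: linear in the first entry, conjugate-linear in the second. -/
def IsSesq (Ω : V → V → ℂ) : Prop :=
  (∀ η : V, IsLinearMap ℂ fun ξ => Ω ξ η) ∧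
    ∀ ξ : V, IsLinearMap ℂ fun η => (starRingEnd ℂ) (Ω ξ η)

/-- `T` is a positive form: `T(ξ,ξ) ≥ 0` for every `ξ`. -/
def IsPositiveForm (T : V → V → ℂ) : Prop :=
  ∀ x : V, (T x x).im = 0 ∧ 0 ≤ (T x x).re

/-- The norm `n` is compatible with the positive sesquilinear form `T`. -/
def CompatibleWithForm (T : V → V → ℂ) (n : V → ℝ) : Prop :=
  (∃ α : ℝ, 0 < α ∧ ∀ ξ : V, (T ξ ξ).re ≤ α * n ξ ^ 2) ∧
    ∀ ξ : ℕ → V, Tendsto (fun k => (T (ξ k) (ξ k)).re) atTop (𝓝 0) →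
      IsCauchyWrt n ξ → Tendsto (fun k => n (ξ k)) atTop (𝓝 0)

/-- A realization of `(V, n)` as a dense subspace of a reflexive Banach space `E`. -/
structure BanachModel (V : Type) [AddCommGroup V] [Module ℂ V] (n : V → ℝ) : Type 1 where
  E : Type
  [instGroup : NormedAddCommGroup E]
  [instSpace : NormedSpace ℂ E]
  [instComplete : CompleteSpace E]
  j : V →ₗ[ℂ] E
  isometry : ∀ x : V, ‖j x‖ = n x
  dense : DenseRange j
  reflexive : Surjective (NormedSpace.inclusionInDoubleDual ℂ E)

/-- `V` endowed with the norm `n` is a reflexive Banach space. -/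
def IsReflexiveBanachWrt (n : V → ℝ) : Prop :=
  ∃ M : BanachModel V n, Surjective M.j

/-- The completion of `V` with respect to the norm `n` is a reflexive Banach space. -/
def CompletionIsReflexiveBanach (n : V → ℝ) : Prop :=
  Nonempty (BanachModel V n)

variable {H : Type} [NormedAddCommGroup H] [InnerProductSpace ℂ H]

/-- The embedding of `D[n]` into `H` is continuous. -/
def EmbedsContinuously (D : Submodule ℂ H) (n : D → ℝ) : Prop :=
  ∃ α : ℝ, 0 < α ∧ ∀ ξ : D, ‖(ξ : H)‖ ≤ α * n ξ

/-- The norm `n` on `D` is compatible with the inner product of `H`. -/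
def CompatibleWithInner (D : Submodule ℂ H) (n : D → ℝ) : Prop :=
  EmbedsContinuously D n ∧
    ∀ ξ : ℕ → D, Tendsto (fun k => ‖(ξ k : H)‖) atTop (𝓝 0) →
      IsCauchyWrt n ξ → Tendsto (fun k => n (ξ k)) atTop (𝓝 0)

/-- The form `Ω` is bounded on `D[n]`. -/
def BoundedOn (D : Submodule ℂ H) (Ω : D → D → ℂ) (n : D → ℝ) : Prop :=
  ∃ β : ℝ, 0 < β ∧ ∀ ξ η : D, ‖Ω ξ η‖ ≤ β * n ξ * n η

/-- `Ω` is q-closed with respect to the norm `n` (Definition 5.2 of Di Bella–Trapani). -/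
def IsQClosed (D : Submodule ℂ H) (Ω : D → D → ℂ) (n : D → ℝ) : Prop :=
  IsNormFn n ∧ CompatibleWithInner D n ∧ IsReflexiveBanachWrt n ∧ BoundedOn D Ω n

/-- `Ω` is q-closable with respect to the norm `n`. -/
def IsQClosable (D : Submodule ℂ H) (Ω : D → D → ℂ) (n : D → ℝ) : Prop :=
  IsNormFn n ∧ CompatibleWithInner D n ∧ CompletionIsReflexiveBanach n ∧ BoundedOn D Ω n

/-- `Λ` is a bounded conjugate-linear functional on `D[n]`,
i.e. an element of the conjugate dual of `D[n]`. -/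
def MemConjDual (D : Submodule ℂ H) (n : D → ℝ) (Λ : D → ℂ) : Prop :=
  (∀ x y : D, Λ (x + y) = Λ x + Λ y) ∧
    (∀ (c : ℂ) (x : D), Λ (c • x) = (starRingEnd ℂ) c * Λ x) ∧
      ∃ C : ℝ, ∀ x : D, ‖Λ x‖ ≤ C * n x

/-- `Υ` is a bounded sesquilinear form on `H`. -/
def IsBoundedForm (Υ : H → H → ℂ) : Prop :=
  IsSesq Υ ∧ ∃ C : ℝ, ∀ x y : H, ‖Υ x y‖ ≤ C * ‖x‖ * ‖y‖

/-- `Υ ∈ P₀(Ω)`: `N(Ω+Υ) = {0}` and every element of the conjugate dual of `D[n]`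
is represented by `Ω+Υ`. -/
def InP0 (D : Submodule ℂ H) (Ω : D → D → ℂ) (n : D → ℝ) (Υ : H → H → ℂ) : Prop :=
  (∀ ξ : D, (∀ η : D, Ω ξ η + Υ ↑ξ ↑η = 0) → ξ = 0) ∧
    ∀ Λ : D → ℂ, MemConjDual D n Λ → ∃ ξ : D, ∀ η : D, Λ η = Ω ξ η + Υ ↑ξ ↑η

/-- `Ω` is solvable with respect to the norm `n`. -/
def IsSolvable (D : Submodule ℂ H) (Ω : D → D → ℂ) (n : D → ℝ) : Prop :=
  IsQClosed D Ω n ∧ ∃ Υ : H → H → ℂ, IsBoundedForm Υ ∧ InP0 D Ω n Υ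

/-- The numerical range of a form on `D`. -/
def NumRangeForm (D : Submodule ℂ H) (Ω : D → D → ℂ) : Set ℂ :=
  {z : ℂ | ∃ ξ : D, ‖(ξ : H)‖ = 1 ∧ z = Ω ξ ξ}

/-- The numerical range of a form on `H`. -/
def NumRangeFormH (Υ : H → H → ℂ) : Set ℂ :=
  {z : ℂ | ∃ x : H, ‖x‖ = 1 ∧ z = Υ x x}

/-- `sup { |Θ(ξ,η)| : ‖η‖_Ω = 1 }`. -/
def FormSup (D : Submodule ℂ H) (Θ : D → D → ℂ) (n : D → ℝ) (ξ : D) : ℝ :=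
  sSup {r : ℝ | ∃ η : D, n η = 1 ∧ r = ‖Θ ξ η‖}

end Paper

namespace Paper

/-- Existence of a self-dual convex gauge for a bounded symmetric form. -/
theorem exists_selfdual {E : Type} [NormedAddCommGroup E] [NormedSpace ℝ E]
    (c : E →ₗ[ℝ] E →ₗ[ℝ] ℝ) (C : ℝ) (hC : ∀ x y, |c x y| ≤ C * ‖x‖ * ‖y‖) (hC0 : 0 ≤ C)
    (hsymm : ∀ x y, c x y = c y x) :
    ∃ k : E → ℝ, (∀ x, k x ≤ C * ‖x‖ ^ 2) ∧ (∀ x y, 2 * |c x y| ≤ k x + k y) ∧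
      (∀ y α, (∀ x, 2 * |c x y| - k x ≤ α) → k y ≤ α) := by
  let S : Set (E → ℝ)ᵒᵈ := {k | ∀ x y, 2 * |c x y| ≤ OrderDual.ofDual k x + OrderDual.ofDual k y}
  have hS0 : OrderDual.toDual (fun x : E => C * ‖x‖ ^ 2) ∈ S := by
    intro x y
    show 2 * |c x y| ≤ C * ‖x‖ ^ 2 + C * ‖y‖ ^ 2
    nlinarith [hC x y, mul_nonneg hC0 (sq_nonneg (‖x‖ - ‖y‖))]
  have hchain : ∀ T ⊆ S, IsChain (· ≤ ·) T → ∀ y ∈ T, ∃ ub ∈ S, ∀ z ∈ T, z ≤ ub := by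
    intro T hT hch k₁ hk₁
    have hbdd : ∀ x, BddBelow ((fun k : (E → ℝ)ᵒᵈ => OrderDual.ofDual k x) '' T) := by
      intro x
      refine ⟨0, ?_⟩
      rintro _ ⟨k, hk, rfl⟩
      have := hT hk x x
      have h2 := abs_nonneg (c x x)
      show 0 ≤ OrderDual.ofDual k x
      linarith
    refine ⟨OrderDual.toDual
      (fun x => sInf ((fun k : (E → ℝ)ᵒᵈ => OrderDual.ofDual k x) '' T)), ?_, ?_⟩
    · intro x y
      show 2 * |c x y| ≤ sInf ((fun k : (E → ℝ)ᵒᵈ => OrderDual.ofDual k x) '' T) +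
        sInf ((fun k : (E → ℝ)ᵒᵈ => OrderDual.ofDual k y) '' T)
      have h1 : ∀ k ∈ T, ∀ l ∈ T, 2 * |c x y| ≤ OrderDual.ofDual k x + OrderDual.ofDual l y := by
        intro k hk l hl
        rcases hch.total hk hl with h | h
        · have h3 : OrderDual.ofDual l x ≤ OrderDual.ofDual k x := h x
          have := hT hl x y
          linarith
        · have h3 : OrderDual.ofDual k y ≤ OrderDual.ofDual l y := h y
          have := hT hk x y
          linarith
      have h2 : ∀ k ∈ T, 2 * |c x y| - OrderDual.ofDual k x ≤
          sInf ((fun k : (E → ℝ)ᵒᵈ => OrderDual.ofDual k y) '' T) := by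
        intro k hk
        refine le_csInf ⟨_, k₁, hk₁, rfl⟩ ?_
        rintro _ ⟨l, hl, rfl⟩
        have := h1 k hk l hl
        show _ ≤ OrderDual.ofDual l y
        linarith
      have h3 : 2 * |c x y| - sInf ((fun k : (E → ℝ)ᵒᵈ => OrderDual.ofDual k y) '' T) ≤
          sInf ((fun k : (E → ℝ)ᵒᵈ => OrderDual.ofDual k x) '' T) := by
        refine le_csInf ⟨_, k₁, hk₁, rfl⟩ ?_
        rintro _ ⟨l, hl, rfl⟩
        have := h2 l hl
        show _ ≤ OrderDual.ofDual l x
        linarith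
      linarith
    · intro k hk x
      exact csInf_le (hbdd x) ⟨k, hk, rfl⟩
  obtain ⟨k, hk0, hkS, hkmax⟩ := zorn_le_nonempty₀ S hchain _ hS0
  refine ⟨OrderDual.ofDual k, fun x => hk0 x, fun x y => hkS x y, ?_⟩
  set κ : E → ℝ := OrderDual.ofDual k with hκ
  have hκS : ∀ x y, 2 * |c x y| ≤ κ x + κ y := fun x y => hkS x y
  have hbd : ∀ y, BddAbove (Set.range fun x => 2 * |c x y| - κ x) := by
    intro y
    refine ⟨κ y, ?_⟩
    rintro _ ⟨x, rfl⟩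
    have := hκS x y
    show 2 * |c x y| - κ x ≤ κ y
    linarith
  let κ' : E → ℝ := fun y => ⨆ x, (2 * |c x y| - κ x)
  have hκ'le : ∀ y, κ' y ≤ κ y := fun y => ciSup_le fun x => by
    have := hκS x y
    linarith
  have hκ'ge : ∀ x y, 2 * |c x y| - κ x ≤ κ' y := fun x y => le_ciSup (hbd y) x
  have hmem : OrderDual.toDual (fun x => (κ x + κ' x) / 2) ∈ S := by
    intro x y
    show 2 * |c x y| ≤ (κ x + κ' x) / 2 + (κ y + κ' y) / 2
    have h1 := hκ'ge x y
    have h2 := hκ'ge y x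
    rw [hsymm y x] at h2
    linarith
  have hle : k ≤ OrderDual.toDual (fun x => (κ x + κ' x) / 2) := by
    intro x
    show (κ x + κ' x) / 2 ≤ κ x
    linarith [hκ'le x]
  intro y α hα
  have h := hkmax hmem hle y
  have h' : κ y ≤ (κ y + κ' y) / 2 := h
  have : κ' y ≤ α := ciSup_le hα
  linarith

theorem extend_point {E : Type} [NormedAddCommGroup E] [NormedSpace ℝ E]
    (c : E →ₗ[ℝ] E →ₗ[ℝ] ℝ) (C : ℝ) (hC : ∀ x y, |c x y| ≤ C * ‖x‖ * ‖y‖) (hC0 : 0 ≤ C)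
    (hsymm : ∀ x y, c x y = c y x)
    (hrep : ∀ g : E →L[ℝ] ℝ, ∃ y, ∀ x, g x = c x y)
    (ξ : ℕ → E) (δ : ℕ → ℝ) (h : ∀ p q, -(δ p + δ q) ≤ c (ξ p - ξ q) (ξ p - ξ q)) :
    ∃ y, ∀ j, -δ j ≤ c (ξ j - y) (ξ j - y) := by
  obtain ⟨k, hkC, hk2, hksd⟩ := exists_selfdual c C hC hC0 hsymm
  have heven : ∀ y, k (-y) ≤ k y := by
    intro y
    apply hksd
    intro x
    have := hk2 x y
    simp only [map_neg, abs_neg]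
    linarith
  have hconv : ConvexOn ℝ Set.univ k := by
    refine ⟨convex_univ, ?_⟩
    intro x _ y _ a b ha hb hab
    apply hksd
    intro z
    simp only [map_add, map_smul, smul_eq_mul]
    have h1 := hk2 z x
    have h2 := hk2 z y
    have h3 : |a * c z x + b * c z y| ≤ a * |c z x| + b * |c z y| := by
      refine (abs_add_le _ _).trans ?_
      rw [abs_mul, abs_mul, abs_of_nonneg ha, abs_of_nonneg hb]
    have h4 : k z = a * k z + b * k z := by rw [← add_mul, hab, one_mul]
    have h5 := mul_le_mul_of_nonneg_left h1 ha
    have h6 := mul_le_mul_of_nonneg_left h2 hb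
    linarith
  have hcont : Continuous k := by
    rw [← continuousOn_univ]
    refine ((hconv.continuousOn_tfae isOpen_univ ⟨0, trivial⟩).out 3 1).mp ?_
    refine ⟨0, trivial, C, ?_⟩
    rw [Filter.eventually_map]
    filter_upwards [Metric.ball_mem_nhds (0 : E) one_pos] with x hx
    have hx1 : ‖x‖ < 1 := by simpa using hx
    have := hkC x
    have h2 : ‖x‖ ^ 2 ≤ 1 := by nlinarith [norm_nonneg x]
    nlinarith
  let s : Set (E × ℝ) := {z | z.2 < -k z.1}
  let G : Set (E × ℝ) := Set.range fun j => (ξ j, c (ξ j) (ξ j) + δ j)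
  have hs1 : Convex ℝ s := by
    intro z hz w hw a b ha hb hab
    have hz' : z.2 < -k z.1 := hz
    have hw' : w.2 < -k w.1 := hw
    show a * z.2 + b * w.2 < -k (a • z.1 + b • w.1)
    have h1 := hconv.2 (Set.mem_univ z.1) (Set.mem_univ w.1) ha hb hab
    simp only [smul_eq_mul] at h1
    rcases ha.eq_or_lt with rfl | ha'
    · have : b = 1 := by linarith
      subst this
      linarith
    · nlinarith [mul_lt_mul_of_pos_left hz' ha', mul_le_mul_of_nonneg_left hw'.le hb]
  have hs2 : IsOpen s := isOpen_lt continuous_snd (hcont.comp continuous_fst).neg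
  have hcv : ∀ w : E × ℝ, Convex ℝ {z : E × ℝ | 2 * c z.1 w.1 ≤ z.2 + w.2} := by
    intro w z hz z' hz' a b ha hb hab
    have h1 : 2 * c z.1 w.1 ≤ z.2 + w.2 := hz
    have h2 : 2 * c z'.1 w.1 ≤ z'.2 + w.2 := hz'
    show 2 * c (a • z.1 + b • z'.1) w.1 ≤ (a * z.2 + b * z'.2) + w.2
    simp only [map_add, map_smul, smul_eq_mul, LinearMap.add_apply, LinearMap.smul_apply]
    have h5 := mul_le_mul_of_nonneg_left h1 ha
    have h6 := mul_le_mul_of_nonneg_left h2 hb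
    have h4 : w.2 = a * w.2 + b * w.2 := by rw [← add_mul, hab, one_mul]
    linarith
  have hA : ∀ w ∈ G, ∀ z ∈ convexHull ℝ G, 2 * c z.1 w.1 ≤ z.2 + w.2 := by
    rintro _ ⟨j, rfl⟩
    apply convexHull_min _ (hcv _)
    rintro _ ⟨i, rfl⟩
    show 2 * c (ξ i) (ξ j) ≤ (c (ξ i) (ξ i) + δ i) + (c (ξ j) (ξ j) + δ j)
    have := h i j
    simp only [map_sub, LinearMap.sub_apply] at this
    linarith [hsymm (ξ i) (ξ j)]
  have hB : ∀ w ∈ convexHull ℝ G, ∀ z ∈ convexHull ℝ G, 2 * c z.1 w.1 ≤ z.2 + w.2 := by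
    intro w hw
    apply convexHull_min _ (hcv _)
    intro z hz
    have := hA z hz w hw
    show 2 * c z.1 w.1 ≤ z.2 + w.2
    linarith [hsymm z.1 w.1]
  have hdisj : Disjoint s (convexHull ℝ G) := by
    rw [Set.disjoint_left]
    intro z hz hzG
    have h1 : z.2 < -k z.1 := hz
    have h2 := hB z hzG z hzG
    have h3 := hk2 z.1 z.1
    have h4 := neg_abs_le (c z.1 z.1)
    linarith
  obtain ⟨F, u, hFs, hFG⟩ := geometric_hahn_banach_open hs1 hs2 (convex_convexHull ℝ G) hdisj
  have hFdec : ∀ x t, F (x, t) = F (x, 0) + t * F (0, 1) := by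
    intro x t
    have : ((x, t) : E × ℝ) = (x, 0) + t • (0, 1) := by simp
    rw [this, map_add, map_smul, smul_eq_mul]
  set β := F (0, 1) with hβ
  have hFG' : ∀ j, u ≤ F (ξ j, 0) + (c (ξ j) (ξ j) + δ j) * β := by
    intro j
    rw [← hFdec]
    exact hFG _ (subset_convexHull ℝ G ⟨j, rfl⟩)
  have hFs' : ∀ x t, t < -k x → F (x, 0) + t * β < u := by
    intro x t ht
    rw [← hFdec]
    exact hFs (x, t) ht
  have hβpos : 0 < β := by
    by_contra hneg
    have hneg : β ≤ 0 := not_lt.mp hneg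
    have h1 := hFG' 0
    have h2 := hFs' (ξ 0) (min (-k (ξ 0) - 1) (c (ξ 0) (ξ 0) + δ 0))
      (lt_of_le_of_lt (min_le_left _ _) (by linarith))
    have h3 := mul_le_mul_of_nonpos_right
      (min_le_right (-k (ξ 0) - 1) (c (ξ 0) (ξ 0) + δ 0)) hneg
    linarith
  have hle : ∀ x, F (x, 0) - k x * β ≤ u := by
    intro x
    by_contra hlt
    push Not at hlt
    set e := F (x, 0) - k x * β - u with he
    have he0 : 0 < e := by linarith
    have h1 := hFs' x (-k x - e / (2 * β)) (by
      have : 0 < e / (2 * β) := by positivity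
      linarith)
    have h2 : e / (2 * β) * β = e / 2 := by field_simp
    have h3 : (-k x - e / (2 * β)) * β = - (k x * β) - e / 2 := by rw [← h2]; ring
    linarith
  obtain ⟨y, hy⟩ := hrep ((-(2 * β)⁻¹) • (F.comp (ContinuousLinearMap.inl ℝ E ℝ)))
  have hy' : ∀ x, F (x, 0) = -(2 * β) * c x y := by
    intro x
    rw [← hy x]
    simp
    field_simp
  have hα : ∀ x, -2 * c x y - k x ≤ u / β := by
    intro x
    rw [le_div_iff₀ hβpos]
    have := hle x
    rw [hy'] at this
    linarith
  have hky : k y ≤ u / β := by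
    apply hksd
    intro x
    have h1 := hα x
    have h2 := hα (-x)
    have h3 := heven x
    simp only [map_neg, LinearMap.neg_apply] at h2
    rcases abs_cases (c x y) with ⟨h4, _⟩ | ⟨h4, _⟩ <;> rw [h4] <;> linarith
  refine ⟨y, fun j => ?_⟩
  have h1 := hFG' j
  rw [hy'] at h1
  have h2 : u / β ≤ c (ξ j) (ξ j) + δ j - 2 * c (ξ j) y := by
    rw [div_le_iff₀ hβpos]
    linarith
  have h3 := hk2 y y
  have h4 := neg_abs_le (c y y)
  simp only [map_sub, LinearMap.sub_apply]
  linarith [hsymm (ξ j) y]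

theorem sesq_facts {V : Type} [AddCommGroup V] [Module ℂ V] (B : V → V → ℂ) (hB : IsSesq B) :
    (∀ x y z, B (x + y) z = B x z + B y z) ∧ (∀ (a : ℂ) x z, B (a • x) z = a * B x z) ∧
    (∀ x y z, B z (x + y) = B z x + B z y) ∧
    (∀ (a : ℂ) x z, B z (a • x) = (starRingEnd ℂ) a * B z x) := by
  refine ⟨fun x y z => (hB.1 z).map_add x y, fun a x z => (hB.1 z).map_smul a x,
    fun x y z => ?_, fun a x z => ?_⟩
  · have := (hB.2 z).map_add x y
    apply (starRingEnd ℂ).injective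
    rw [map_add]
    exact this
  · have := (hB.2 z).map_smul a x
    apply (starRingEnd ℂ).injective
    rw [map_mul, Complex.conj_conj]
    exact this

theorem symm_case {V : Type} [AddCommGroup V] [Module ℂ V] {E : Type} [NormedAddCommGroup E]
    [NormedSpace ℂ E] (e : V ≃ₗ[ℂ] E) (B : V → V → ℂ) (hB : IsSesq B) (C : ℝ) (hC0 : 0 ≤ C)
    (hC : ∀ x y, ‖B x y‖ ≤ C * ‖e x‖ * ‖e y‖) (him : ∀ x, (B x x).im = 0)
    (hrep : ∀ Λ : V → ℂ, (∀ x y, Λ (x + y) = Λ x + Λ y) →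
      (∀ (a : ℂ) x, Λ (a • x) = (starRingEnd ℂ) a * Λ x) → (∃ K : ℝ, ∀ x, ‖Λ x‖ ≤ K * ‖e x‖) →
      ∃ ξ, ∀ η, Λ η = B ξ η)
    (ξ : ℕ → V) (δ : ℕ → ℝ) (h : ∀ p q, (B (ξ p - ξ q) (ξ p - ξ q)).re ≤ δ p + δ q) :
    ∃ y, ∀ j, (B (ξ j - y) (ξ j - y)).re ≤ δ j := by
  obtain ⟨hadd, hsmul, hadd', hsmul'⟩ := sesq_facts B hB
  have hsymm : ∀ x y, (B x y).re = (B y x).re := by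
    intro x y
    have h1 := him (x + Complex.I • y)
    simp only [hadd, hadd', hsmul, hsmul'] at h1
    have h2 := him x
    have h3 := him y
    simp at h1
    linarith
  have hrs : ∀ (a : ℝ) (x : E), e.symm (a • x) = (a : ℂ) • e.symm x := by
    intro a x
    rw [← map_smul]
    congr 1
  let c : E →ₗ[ℝ] E →ₗ[ℝ] ℝ := LinearMap.mk₂ ℝ (fun x y => -(B (e.symm x) (e.symm y)).re)
    (by intro x y z; simp only [map_add, hadd, Complex.add_re]; ring)
    (by intro a x z; simp only [hrs, hsmul, Complex.re_ofReal_mul, smul_eq_mul]; ring)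
    (by intro x y z; simp only [map_add, hadd', Complex.add_re]; ring)
    (by intro a x z; simp only [hrs, hsmul', Complex.conj_ofReal, Complex.re_ofReal_mul, smul_eq_mul]; ring)
  have hc : ∀ x y, c x y = -(B (e.symm x) (e.symm y)).re := fun x y => rfl
  obtain ⟨y, hy⟩ := extend_point c C (by
      intro x y
      rw [hc, abs_neg]
      refine (Complex.abs_re_le_norm _).trans ?_
      simpa using hC (e.symm x) (e.symm y)) hC0
    (by intro x y; rw [hc, hc, hsymm])
    (by
      intro g
      obtain ⟨w, hw⟩ := hrep (fun η => -(starRingEnd ℂ) (StrongDual.extendRCLike (𝕜 := ℂ) g (e η)))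
        (by intro x y; simp only [map_add]; ring)
        (by intro a x; simp only [map_smul, smul_eq_mul, map_mul]; ring)
        ⟨‖g‖, fun x => by
          rw [norm_neg, RCLike.norm_conj]
          exact StrongDual.norm_extendRCLike_bound g (e x)⟩
      refine ⟨e w, fun x => ?_⟩
      rw [hc, hsymm, e.symm_apply_apply, ← hw, e.apply_symm_apply]
      have := StrongDual.re_extendRCLike_apply (𝕜 := ℂ) g x
      simp only [Complex.neg_re, Complex.conj_re, neg_neg]
      exact this.symm)
    (fun j => e (ξ j)) δ (by
      intro p q
      have := h p q
      rw [hc, ← map_sub, e.symm_apply_apply]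
      linarith)
  refine ⟨e.symm y, fun j => ?_⟩
  have := hy j
  rw [hc, map_sub, e.symm_apply_apply] at this
  linarith

theorem sect_cs {V : Type} [AddCommGroup V] [Module ℂ V] (B : V → V → ℂ) (hB : IsSesq B)
    (M : ℝ) (hM : 0 ≤ M) (hpos : ∀ x, 0 ≤ (B x x).re) (him : ∀ x, |(B x x).im| ≤ M * (B x x).re)
    (x y : V) : ‖B x y‖ ≤ 2 * (1 + M) * (Real.sqrt (B x x).re * Real.sqrt (B y y).re) := by
  obtain ⟨hadd, hsmul, hadd', hsmul'⟩ := sesq_facts B hB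
  have hn : ∀ x, ‖B x x‖ ≤ (1 + M) * (B x x).re := by
    intro x
    have := Complex.norm_le_abs_re_add_abs_im (B x x)
    rw [abs_of_nonneg (hpos x)] at this
    linarith [him x]
  have hpol : ∀ x y, ‖B x y‖ ≤ (1 + M) * ((B x x).re + (B y y).re) := by
    intro x y
    have h4 : 4 * B x y = B (x + y) (x + y) - B (x + (-1 : ℂ) • y) (x + (-1 : ℂ) • y)
        + (Complex.I * B (x + Complex.I • y) (x + Complex.I • y)
        - Complex.I * B (x + (-Complex.I) • y) (x + (-Complex.I) • y)) := by
      simp only [hadd, hadd', hsmul, hsmul', map_neg, map_one, Complex.conj_I]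
      linear_combination (2 * B x y - 2 * B y x) * Complex.I_sq
    have h5 : (B (x + y) (x + y)).re + (B (x + (-1 : ℂ) • y) (x + (-1 : ℂ) • y)).re
        + ((B (x + Complex.I • y) (x + Complex.I • y)).re
        + (B (x + (-Complex.I) • y) (x + (-Complex.I) • y)).re)
        = 4 * ((B x x).re + (B y y).re) := by
      simp only [hadd, hadd', hsmul, hsmul', map_neg, map_one, Complex.conj_I]
      simp
      ring
    have h6 : ‖4 * B x y‖ ≤ (‖B (x + y) (x + y)‖ + ‖B (x + (-1 : ℂ) • y) (x + (-1 : ℂ) • y)‖)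
        + (‖B (x + Complex.I • y) (x + Complex.I • y)‖
        + ‖B (x + (-Complex.I) • y) (x + (-Complex.I) • y)‖) := by
      rw [h4]
      refine (norm_add_le _ _).trans (add_le_add (norm_sub_le _ _) ?_)
      refine (norm_sub_le _ _).trans ?_
      simp
    rw [norm_mul] at h6
    have h7 : ‖(4 : ℂ)‖ = 4 := by norm_num
    rw [h7] at h6
    have a1 := hn (x + y)
    have a2 := hn (x + (-1 : ℂ) • y)
    have a3 := hn (x + Complex.I • y)
    have a4 := hn (x + (-Complex.I) • y)
    have h8 := congrArg (fun t => (1 + M) * t) h5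
    beta_reduce at h8
    linarith
  have hd : discrim ((1 + M) * (B x x).re) (-‖B x y‖) ((1 + M) * (B y y).re) ≤ 0 := by
    apply discrim_le_zero
    intro t
    have h1 := hpol ((t : ℂ) • x) y
    simp only [hsmul, hsmul', Complex.conj_ofReal, norm_mul, Complex.norm_real,
      Real.norm_eq_abs, Complex.re_ofReal_mul] at h1
    have h2 := mul_le_mul_of_nonneg_right (le_abs_self t) (norm_nonneg (B x y))
    linarith
  rw [discrim] at hd
  apply le_of_sq_le_sq _ (by positivity)
  rw [mul_pow, mul_pow, mul_pow, Real.sq_sqrt (hpos x), Real.sq_sqrt (hpos y)]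
  linarith

theorem sect_case {V : Type} [AddCommGroup V] [Module ℂ V] (n : V → ℝ)
    (B : V → V → ℂ) (hB : IsSesq B) (C : ℝ) (hn0 : ∀ x, 0 ≤ n x)
    (hC : ∀ x y, ‖B x y‖ ≤ C * n x * n y) (hC0 : 0 ≤ C)
    (M : ℝ) (hM : 0 ≤ M) (hpos : ∀ x, 0 ≤ (B x x).re) (him : ∀ x, |(B x x).im| ≤ M * (B x x).re)
    (hrep : ∀ Λ : V → ℂ, (∀ x y, Λ (x + y) = Λ x + Λ y) →
      (∀ (a : ℂ) x, Λ (a • x) = (starRingEnd ℂ) a * Λ x) → (∃ K : ℝ, ∀ x, ‖Λ x‖ ≤ K * n x) →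
      ∃ ξ, ∀ η, Λ η = B ξ η) :
    CompleteWrt (fun x => Real.sqrt (B x x).re) := by
  obtain ⟨hadd, hsmul, hadd', hsmul'⟩ := sesq_facts B hB
  have hsub : ∀ x y z, B (x - y) z = B x z - B y z := fun x y z => (hB.1 z).map_sub x y
  have hcs := sect_cs B hB M hM hpos him
  intro ξ hξ
  set N : V → ℝ := fun x => Real.sqrt (B x x).re with hN
  have hN0 : ∀ x, 0 ≤ N x := fun x => Real.sqrt_nonneg _
  have hNn : ∀ x, N x ≤ Real.sqrt C * n x := by
    intro x
    rw [hN]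
    apply Real.sqrt_le_iff.mpr
    refine ⟨mul_nonneg (Real.sqrt_nonneg _) (hn0 x), ?_⟩
    rw [mul_pow, Real.sq_sqrt hC0]
    have := hC x x
    have h2 := Complex.re_le_norm (B x x)
    nlinarith
  set K := 2 * (1 + M) with hK
  have hKpos : 0 < K := by positivity
  have hcau : ∀ η, CauchySeq fun k => B (ξ k) η := by
    intro η
    rw [Metric.cauchySeq_iff]
    intro ε hε
    obtain ⟨N₀, h0⟩ := hξ (ε / (K * (N η + 1))) (by have := hN0 η; positivity)
    refine ⟨N₀, fun p hp q hq => ?_⟩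
    rw [dist_eq_norm, ← hsub]
    refine (hcs _ _).trans_lt ?_
    have h1 := h0 p q hp hq
    have h3 := hN0 η
    rw [lt_div_iff₀ (by positivity)] at h1
    have h2 := hN0 (ξ p - ξ q)
    change K * (N (ξ p - ξ q) * N η) < ε
    nlinarith [mul_nonneg hKpos.le h2]
  choose Λ hΛ using fun η => cauchySeq_tendsto_of_complete (hcau η)
  obtain ⟨N₁, h1⟩ := hξ 1 one_pos
  have hbd : ∀ (ε : ℝ) (N₀ : ℕ), (∀ p q, N₀ ≤ p → N₀ ≤ q → N (ξ p - ξ q) < ε) →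
      ∀ p, N₀ ≤ p → ∀ η, ‖B (ξ p) η - Λ η‖ ≤ K * (ε * N η) := by
    intro ε N₀ h0 p hp η
    have ht : Tendsto (fun q => ‖B (ξ p) η - B (ξ q) η‖) atTop (𝓝 ‖B (ξ p) η - Λ η‖) :=
      (tendsto_const_nhds.sub (hΛ η)).norm
    refine le_of_tendsto ht ?_
    filter_upwards [eventually_ge_atTop N₀] with q hq
    rw [← hsub]
    refine (hcs _ _).trans ?_
    have := (h0 p q hp hq).le
    have h3 := hN0 η
    change K * (N (ξ p - ξ q) * N η) ≤ K * (ε * N η)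
    gcongr
  obtain ⟨x, hx⟩ := hrep Λ
    (by
      intro a b
      refine tendsto_nhds_unique (hΛ (a + b)) ?_
      simp only [hadd']
      exact (hΛ a).add (hΛ b))
    (by
      intro a b
      refine tendsto_nhds_unique (hΛ (a • b)) ?_
      simp only [hsmul']
      exact (hΛ b).const_mul _)
    ⟨C * n (ξ N₁) + K * Real.sqrt C, by
      intro η
      have h2 := hbd 1 N₁ h1 N₁ le_rfl η
      have h3 := hC (ξ N₁) η
      have h4 : ‖Λ η‖ ≤ ‖B (ξ N₁) η‖ + ‖B (ξ N₁) η - Λ η‖ := by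
        have := norm_sub_le (B (ξ N₁) η) (B (ξ N₁) η - Λ η)
        simpa using this
      have h5 := mul_le_mul_of_nonneg_left (hNn η) hKpos.le
      linarith⟩
  refine ⟨x, ?_⟩
  unfold TendstoWrt
  rw [Metric.tendsto_atTop]
  intro ε hε
  obtain ⟨N₀, h0⟩ := hξ (ε / (2 * K)) (by positivity)
  refine ⟨N₀, fun p hp => ?_⟩
  have h2 := hbd _ N₀ h0 p hp (ξ p - x)
  rw [hx, ← hsub] at h2
  have h3 := Complex.re_le_norm (B (ξ p - x) (ξ p - x))
  have h4 : N (ξ p - x) ^ 2 = (B (ξ p - x) (ξ p - x)).re := Real.sq_sqrt (hpos _)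
  have h5 : K * (ε / (2 * K) * N (ξ p - x)) = ε / 2 * N (ξ p - x) := by field_simp
  have h6 := hN0 (ξ p - x)
  rw [Real.dist_eq, sub_zero]
  change |N (ξ p - x)| < ε
  rw [abs_of_nonneg h6]
  by_contra hcon
  push Not at hcon
  nlinarith

/-- From a Cauchy sequence produce a null majorant (after a shift). -/
theorem cauchy_majorant {V : Type} [AddCommGroup V] [Module ℂ V] (Q : V → ℝ) (ξ : ℕ → V)
    (hξ : IsCauchyWrt (fun x => Real.sqrt (Q x)) ξ) :
    ∃ (N : ℕ) (δ : ℕ → ℝ), Tendsto δ atTop (𝓝 0) ∧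
      ∀ p q, Q (ξ (p + N) - ξ (q + N)) ≤ δ p + δ q := by
  obtain ⟨N, hN⟩ := hξ 1 one_pos
  let w : ℕ → ℕ → ℝ := fun p q => Real.sqrt (Q (ξ (p + N) - ξ (q + N)))
  have hw0 : ∀ p q, 0 ≤ w p q := fun p q => Real.sqrt_nonneg _
  have hw1 : ∀ p q, w p q ≤ 1 := fun p q => (hN _ _ (by omega) (by omega)).le
  let δ : ℕ → ℝ := fun k => ⨆ ij : ℕ × ℕ, w (k + ij.1) (k + ij.2)
  have hb : ∀ k, BddAbove (Set.range fun ij : ℕ × ℕ => w (k + ij.1) (k + ij.2)) := by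
    intro k
    refine ⟨1, ?_⟩
    rintro _ ⟨ij, rfl⟩
    exact hw1 _ _
  have hle : ∀ k p q, k ≤ p → k ≤ q → w p q ≤ δ k := by
    intro k p q hp hq
    have := le_ciSup (hb k) (p - k, q - k)
    simpa [Nat.add_sub_cancel' hp, Nat.add_sub_cancel' hq] using this
  have hδ0 : ∀ k, 0 ≤ δ k := fun k => (hw0 k k).trans (hle k k k le_rfl le_rfl)
  refine ⟨N, δ, ?_, ?_⟩
  · rw [Metric.tendsto_atTop]
    intro ε hε
    obtain ⟨N₀, h0⟩ := hξ (ε / 2) (by positivity)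
    refine ⟨N₀, fun k hk => ?_⟩
    rw [Real.dist_eq, sub_zero, abs_of_nonneg (hδ0 k)]
    have : δ k ≤ ε / 2 := ciSup_le fun ij => (h0 _ _ (by omega) (by omega)).le
    linarith
  · intro p q
    have h1 : Q (ξ (p + N) - ξ (q + N)) ≤ w p q := by
      rcases le_or_gt 0 (Q (ξ (p + N) - ξ (q + N))) with h | h
      · have h2 : w p q ^ 2 = Q (ξ (p + N) - ξ (q + N)) := Real.sq_sqrt h
        nlinarith [hw0 p q, hw1 p q]
      · exact h.le.trans (hw0 p q)
    rcases le_total p q with h | h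
    · linarith [hle p p q le_rfl h, hδ0 q]
    · linarith [hle q p q h le_rfl, hδ0 p]

theorem sectorial_solvable_is_closed {H : Type} [NormedAddCommGroup H] [InnerProductSpace ℂ H]
    [CompleteSpace H] (D : Submodule ℂ H) (hD : Dense (D : Set H))
    (Ω : ↥D → ↥D → ℂ) (hsesq : IsSesq Ω) (γ lam : ℝ) (hlam : lam < γ)
    (hsect : ∃ M : ℝ, 0 ≤ M ∧ ∀ ξ : ↥D, |(Ω ξ ξ).im| ≤ M * ((Ω ξ ξ).re - γ * ‖(ξ : H)‖ ^ 2))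
    (n : ↥D → ℝ) (hq : IsQClosed D Ω n)
    (hP : InP0 D Ω n (fun x y => -(lam : ℂ) * ⟪y, x⟫_ℂ)) :
    CompleteWrt (fun ξ : ↥D => Real.sqrt ((Ω ξ ξ).re - lam * ‖(ξ : H)‖ ^ 2)) := by
  obtain ⟨M, hM, hsec⟩ := hsect
  obtain ⟨hnorm, ⟨⟨a, ha, hemb⟩, -⟩, ⟨mod, hsurj⟩, ⟨b, hb, hbd⟩⟩ := hq
  obtain ⟨hadd, hsmul, hadd', hsmul'⟩ := sesq_facts Ω hsesq
  let B : ↥D → ↥D → ℂ := fun ξ η => Ω ξ η + -(lam : ℂ) * ⟪(η : H), (ξ : H)⟫_ℂ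
  have hB : IsSesq B := by
    refine ⟨fun η => ⟨fun x y => ?_, fun c x => ?_⟩, fun ξ => ⟨fun x y => ?_, fun c x => ?_⟩⟩
    · simp only [B, hadd, Submodule.coe_add, inner_add_right]; ring
    · simp only [B, hsmul, Submodule.coe_smul, inner_smul_right, smul_eq_mul]; ring
    · simp only [B, hadd', Submodule.coe_add, inner_add_left, map_add, map_mul]; ring
    · simp only [B, hsmul', Submodule.coe_smul, inner_smul_left, smul_eq_mul, map_add, map_mul,
        Complex.conj_conj]; ring
  have hinn : ∀ x : ↥D, ⟪(x : H), (x : H)⟫_ℂ = ((‖(x : H)‖ ^ 2 : ℝ) : ℂ) := by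
    intro x
    rw [inner_self_eq_norm_sq_to_K]
    norm_cast
  have hBre : ∀ x, (B x x).re = (Ω x x).re - lam * ‖(x : H)‖ ^ 2 := by
    intro x
    simp only [B, hinn]
    rw [← Complex.ofReal_neg, ← Complex.ofReal_mul, Complex.add_re, Complex.ofReal_re]
    ring
  have hBim : ∀ x, (B x x).im = (Ω x x).im := by
    intro x
    simp only [B, hinn]
    rw [← Complex.ofReal_neg, ← Complex.ofReal_mul, Complex.add_im, Complex.ofReal_im, add_zero]
  have hn0 : ∀ x, 0 ≤ n x := by
    intro x
    rw [← mod.isometry]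
    exact @norm_nonneg _ mod.instGroup.toSeminormedAddCommGroup.toSeminormedAddGroup _
  set C := b + |lam| * a ^ 2 with hCdef
  have hC0 : 0 ≤ C := by positivity
  have hC : ∀ x y, ‖B x y‖ ≤ C * n x * n y := by
    intro x y
    have h1 := hbd x y
    have h2 := norm_inner_le_norm (𝕜 := ℂ) (y : H) (x : H)
    have h3 := hemb x
    have h4 := hemb y
    have h5 : ‖B x y‖ ≤ ‖Ω x y‖ + |lam| * ‖⟪(y : H), (x : H)⟫_ℂ‖ := by
      refine (norm_add_le _ _).trans ?_
      rw [norm_mul, norm_neg, Complex.norm_real, Real.norm_eq_abs]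
    have h6 : ‖(y : H)‖ * ‖(x : H)‖ ≤ (a * n y) * (a * n x) :=
      mul_le_mul h4 h3 (norm_nonneg _) (mul_nonneg ha.le (hn0 y))
    have h7 := mul_le_mul_of_nonneg_left (h2.trans h6) (abs_nonneg lam)
    rw [hCdef]
    linarith
  have hrep : ∀ Λ : ↥D → ℂ, (∀ x y, Λ (x + y) = Λ x + Λ y) →
      (∀ (a : ℂ) x, Λ (a • x) = (starRingEnd ℂ) a * Λ x) → (∃ K : ℝ, ∀ x, ‖Λ x‖ ≤ K * n x) →
      ∃ ξ, ∀ η, Λ η = B ξ η := fun Λ h1 h2 h3 => hP.2 Λ ⟨h1, h2, h3⟩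
  have hgoal : (fun ξ : ↥D => Real.sqrt ((Ω ξ ξ).re - lam * ‖(ξ : H)‖ ^ 2)) =
      fun ξ : ↥D => Real.sqrt (B ξ ξ).re := by
    funext ξ
    rw [hBre]
  rw [hgoal]
  rcases hM.eq_or_lt with hM0 | hMpos
  · -- `M = 0`: the form is symmetric, but no lower bound is available
    subst hM0
    have him : ∀ x, (B x x).im = 0 := by
      intro x
      rw [hBim]
      have := hsec x
      rw [zero_mul] at this
      exact abs_nonpos_iff.mp this
    intro ξ hξ
    obtain ⟨N, δ, hδ, hle⟩ := cauchy_majorant (fun x => (B x x).re) ξ hξ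
    let _ := mod.instGroup
    let _ := mod.instSpace
    have hinj : Function.Injective mod.j := by
      intro x y hxy
      have h1 : n (x - y) = 0 := by
        rw [← mod.isometry, map_sub, hxy, sub_self, norm_zero]
      exact sub_eq_zero.mp ((hnorm.1 _).mp h1)
    let e : ↥D ≃ₗ[ℂ] mod.E := LinearEquiv.ofBijective mod.j ⟨hinj, hsurj⟩
    have he : ∀ x, ‖e x‖ = n x := fun x => mod.isometry x
    obtain ⟨y, hy⟩ := symm_case e B hB C hC0 (by intro x y; rw [he, he]; exact hC x y) him
      (by intro Λ h1 h2 h3; exact hrep Λ h1 h2 (by simpa only [he] using h3))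
      (fun k => ξ (k + N)) δ hle
    refine ⟨y, ?_⟩
    unfold TendstoWrt
    rw [← tendsto_add_atTop_iff_nat N]
    have hs : Tendsto (fun k => Real.sqrt (δ k)) atTop (𝓝 0) := by
      simpa [Function.comp_def] using (Real.continuous_sqrt.tendsto 0).comp hδ
    exact squeeze_zero (fun k => Real.sqrt_nonneg _) (fun k => Real.sqrt_le_sqrt (hy k)) hs
  · have hge : ∀ x : ↥D, 0 ≤ (Ω x x).re - γ * ‖(x : H)‖ ^ 2 := by
      intro x
      have := (abs_nonneg _).trans (hsec x)
      exact nonneg_of_mul_nonneg_right this hMpos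
    have hge2 : ∀ x : ↥D, (Ω x x).re - γ * ‖(x : H)‖ ^ 2 ≤ (B x x).re := by
      intro x
      rw [hBre]
      nlinarith [sq_nonneg ‖(x : H)‖]
    exact sect_case n B hB C hn0 hC hC0 M hM (fun x => (hge x).trans (hge2 x))
      (fun x => by
        rw [hBim]
        exact (hsec x).trans (mul_le_mul_of_nonneg_left (hge2 x) hM)) hrep

end Paper
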